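/- Let Δ = Δ_0 + ⋯ + Δ_k be a nef-partition of a reflexive polytope Δ ⊂ ℝ^d and ∇ = ∇_0 + ⋯ + ∇_k the dual nef-partition. In ℝ^d ⊕ ℝ^k define Δ̂_0 = Conv(Δ_0, Δ_1 + e_1, …, Δ_k + e_k), Δ̂_i = Δ̂_0 − e_i; ∇̂_0 = Conv(∇_0, ∇_1 + e_1*, …, ∇_k + e_k*), ∇̂_i = ∇̂_0 − e_i*; Δ̃_i = Conv((Δ_i + e_i) ∪ {0}); and ∇̃_i = Conv((∇_i + e_i*) ∪ {0}), where e_0 = −(e_1+⋯+e_k) and e_0* = −(e_1*+⋯+e_k*). Then (Δ̃_0 ⊎ ⋯ ⊎ Δ̃_k)* = ∇̂_0 + ⋯ + ∇̂_k and (∇̃_0 ⊎ ⋯ ⊎ ∇̃_k)* = Δ̂_0 + ⋯ + Δ̂_k; these are nef-partitions whose dual nef-partitions are Δ̃_0 + ⋯ + Δ̃_k and ∇̃_0 + ⋯ + ∇̃_k respectively, and (∇̂_0 ⊎ ⋯ ⊎ ∇̂_k)* = Δ̃_0 + ⋯ + Δ̃_k and (Δ̂_0 ⊎ ⋯ ⊎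 Δ̂_k)* = ∇̃_0 + ⋯ + ∇̃_k. -/

import Mathlib

open scoped Pointwise
open Set

noncomputable section

/-- The standard pairing on `ℝ^n`. -/
def pairing {n : ℕ} (x y : Fin n → ℝ) : ℝ := ∑ i, x i * y i

/-- A point of `ℝ^n` lying in the lattice `ℤ^n`. -/
def IsLatticePt {n : ℕ} (x : Fin n → ℝ) : Prop := ∀ i, ∃ z : ℤ, x i = (z : ℝ)

/-- A lattice polytope: the convex hull of finitely many lattice points. -/
def IsLatticePolytope {n : ℕ} (P : Set (Fin n → ℝ)) : Prop :=
  ∃ S : Set (Fin n → ℝ), S.Finite ∧ (∀ x ∈ S, IsLatticePt x) ∧ P = convexHull ℝ S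

/-- The dual polytope `P* = {y | ⟨x,y⟩ ≥ -1 ∀ x ∈ P}`. -/
def polarDual {n : ℕ} (P : Set (Fin n → ℝ)) : Set (Fin n → ℝ) :=
  {y | ∀ x ∈ P, -1 ≤ pairing x y}

/-- A reflexive polytope. -/
def IsReflexive {n : ℕ} (P : Set (Fin n → ℝ)) : Prop :=
  IsLatticePolytope P ∧ (0 : Fin n → ℝ) ∈ interior P ∧ IsLatticePolytope (polarDual P)

/-- `min⟨P, u⟩ = min_{x ∈ P} ⟨x, u⟩`. -/
def minPair {n : ℕ} (P : Set (Fin n → ℝ)) (u : Fin n → ℝ) : ℝ :=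
  sInf ((fun x => pairing x u) '' P)

/-- The real vector space `ℝ^d ⊕ ℝ^k`. -/
abbrev Vdk (d k : ℕ) := (Fin d → ℝ) × (Fin k → ℝ)

/-- The pairing on `ℝ^d ⊕ ℝ^k` (sum of the two standard pairings). -/
def pairingV {d k : ℕ} (x y : Vdk d k) : ℝ := pairing x.1 y.1 + pairing x.2 y.2

def IsLatticePtV {d k : ℕ} (x : Vdk d k) : Prop := IsLatticePt x.1 ∧ IsLatticePt x.2

def IsLatticePolytopeV {d k : ℕ} (P : Set (Vdk d k)) : Prop :=
  ∃ S : Set (Vdk d k), S.Finite ∧ (∀ x ∈ S, IsLatticePtV x) ∧ P = convexHull ℝ S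

def polarDualV {d k : ℕ} (P : Set (Vdk d k)) : Set (Vdk d k) :=
  {y | ∀ x ∈ P, -1 ≤ pairingV x y}

def IsReflexiveV {d k : ℕ} (P : Set (Vdk d k)) : Prop :=
  IsLatticePolytopeV P ∧ (0 : Vdk d k) ∈ interior P ∧ IsLatticePolytopeV (polarDualV P)

/-- The Cayley cone `σ̄ = {(t₀Δ₀ + ⋯ + t_kΔ_k, t₀, …, t_k) : tᵢ ≥ 0} ⊆ ℝ^d ⊕ ℝ^{k+1}`. -/
def cayleyCone {d k : ℕ} (Δ : Fin (k+1) → Set (Fin d → ℝ)) : Set (Vdk d (k+1)) :=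
  {p | (∀ i, 0 ≤ p.2 i) ∧ p.1 ∈ ∑ i, p.2 i • Δ i}

/-- The dual cone of a cone in `ℝ^d ⊕ ℝ^k`. -/
def dualConeV {d k : ℕ} (σ : Set (Vdk d k)) : Set (Vdk d k) :=
  {y | ∀ x ∈ σ, 0 ≤ pairingV x y}

/-- `e₀ = −(e₁ + ⋯ + e_k)`, `eᵢ` the standard basis of the second factor `ℝ^k`. -/
def evec {k : ℕ} : Fin (k+1) → Fin k → ℝ :=
  Fin.cases (fun _ => -1) (fun i => Pi.single i 1)

/-- Shift vectors for `Conv(P₀, P₁ + e₁, …, P_k + e_k)`: no shift for index 0. -/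
def nshift {k : ℕ} : Fin (k+1) → Fin k → ℝ :=
  Fin.cases 0 (fun i => Pi.single i 1)

section NefDuality

variable {E ι : Type*} [NormedAddCommGroup E] [NormedSpace ℝ E] {p : LinearMap.BilinForm ℝ E}

lemma forall_mem_convexHull_iff {S : Set E} {c : ℝ} {y : E} :
    (∀ x ∈ convexHull ℝ S, c ≤ p x y) ↔ ∀ x ∈ S, c ≤ p x y :=
  ⟨fun h x hx => h x (subset_convexHull ℝ S hx),
    fun h => convexHull_min h (convex_halfSpace_ge (p.flip y).isLinear c)⟩

lemma zero_mem_interior_polar [FiniteDimensional ℝ E] {T : Set E} (hT : T.Finite) :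
    (0 : E) ∈ interior {y | ∀ x ∈ convexHull ℝ T, -1 ≤ p x y} := by
  rw [mem_interior]
  refine ⟨⋂ x ∈ T, {y | -1 < p x y}, fun y hy => ?_, ?_, ?_⟩
  · refine forall_mem_convexHull_iff.2 fun x hx => ?_
    exact (mem_iInter₂.1 hy x hx : -1 < p x y).le
  · exact hT.isOpen_biInter fun x _ =>
      isOpen_lt continuous_const (LinearMap.continuous_of_finiteDimensional (p x))
  · simp

lemma exists_pairing_le [FiniteDimensional ℝ E] {A : ι → Set E}
    (hA : ∀ i, IsCompact (A i)) (hA0 : ∀ i, (0 : E) ∈ A i) (v : E) :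
    ∃ a : ι → E, (∀ i, a i ∈ A i) ∧ (∀ i, ∀ x ∈ A i, p (a i) v ≤ p x v) ∧ ∀ i, p (a i) v ≤ 0 := by
  have hc : Continuous fun x => p x v :=
    LinearMap.continuous_of_finiteDimensional (p.flip v)
  choose a ha hmin using fun i => (hA i).exists_isMinOn ⟨0, hA0 i⟩ hc.continuousOn
  have hle : ∀ i, ∀ x ∈ A i, p (a i) v ≤ p x v := fun i x hx => hmin i hx
  exact ⟨a, ha, hle, fun i => by simpa using hle i 0 (hA0 i)⟩

variable [Fintype ι]

/-- Membership in a weighted Minkowski sum. -/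
lemma mem_sum_smul {B : ι → Set E} {r : ι → ℝ} {y : E} :
    y ∈ ∑ i, r i • B i ↔ ∃ b : ι → E, (∀ i, b i ∈ B i) ∧ ∑ i, r i • b i = y := by
  rw [Set.mem_fintype_sum]
  constructor
  · rintro ⟨g, hg, rfl⟩
    choose b hb hbg using fun i => Set.mem_smul_set.1 (hg i)
    exact ⟨b, hb, Finset.sum_congr rfl fun i _ => hbg i⟩
  · rintro ⟨b, hb, rfl⟩
    exact ⟨fun i => r i • b i, fun i => Set.smul_mem_smul_set (hb i), rfl⟩

/-- A subconvex combination of points of a convex set containing `0`, scaled by `r`. -/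
lemma sum_smul_mem_smul_of_sum_le {α : Type*} {B : Set E} (hB : Convex ℝ B) (h0 : (0 : E) ∈ B)
    (T : Finset α) {a : α → ℝ} {z : α → E} {r : ℝ} (ha : ∀ w ∈ T, 0 ≤ a w)
    (hz : ∀ w ∈ T, a w ≠ 0 → z w ∈ B) (hr : ∑ w ∈ T, a w ≤ r) :
    ∑ w ∈ T, a w • z w ∈ r • B := by
  classical
  rcases (Finset.sum_nonneg ha).eq_or_lt with hs | hs
  · have hzero := (Finset.sum_eq_zero_iff_of_nonneg ha).1 hs.symm
    rw [Finset.sum_eq_zero fun w hw => by rw [hzero w hw, zero_smul]]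
    exact ⟨0, h0, smul_zero r⟩
  · set s := ∑ w ∈ T, a w with hsdef
    have hr0 : 0 < r := hs.trans_le hr
    have hb : ∑ w ∈ T, (a w / s) • (if a w = 0 then 0 else z w) ∈ B := by
      refine hB.sum_mem (fun w hw => div_nonneg (ha w hw) hs.le) ?_ fun w hw => ?_
      · rw [← Finset.sum_div, ← hsdef, div_self hs.ne']
      · split_ifs with h
        · exact h0
        · exact hz w hw h
    refine ⟨_, hB.smul_mem_of_zero_mem h0 hb (t := s / r)
      ⟨by positivity, (div_le_one hr0).2 hr⟩, ?_⟩
    simp only [Finset.smul_sum, smul_smul]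
    refine Finset.sum_congr rfl fun w _ => ?_
    split_ifs with h
    · simp [h]
    · congr 1
      field_simp

/-- The families `A` and `B` determine each other as in a dual pair of nef-partitions: for all
nonnegative weights `r`, the points `y` with `⟨x, y⟩ ≥ -r i` on every `A i` form `∑ i, r i • B i`. -/
def IsNefDual (p : LinearMap.BilinForm ℝ E) (A B : ι → Set E) : Prop :=
  ∀ r : ι → ℝ, (∀ i, 0 ≤ r i) → {y | ∀ i, ∀ x ∈ A i, -r i ≤ p x y} = ∑ i, r i • B i

variable {A B : ι → Set E}

lemma IsNefDual.mem_iff (h : IsNefDual p A B) {r : ι → ℝ} (hr : ∀ i, 0 ≤ r i) {y : E} :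
    (∀ i, ∀ x ∈ A i, -r i ≤ p x y) ↔ ∃ b : ι → E, (∀ i, b i ∈ B i) ∧ ∑ i, r i • b i = y := by
  rw [← mem_sum_smul, ← h r hr, mem_ofPred_eq]

lemma IsNefDual.setOf_eq [DecidableEq ι] (h : IsNefDual p A B) (hB0 : ∀ i, (0 : E) ∈ B i)
    (j : ι) : {y | ∀ i, ∀ x ∈ A i, -(if i = j then (1 : ℝ) else 0) ≤ p x y} = B j := by
  rw [h (fun i => if i = j then 1 else 0) fun i => by split_ifs <;> norm_num]
  ext y
  rw [mem_sum_smul]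
  constructor
  · rintro ⟨b, hb, rfl⟩
    simpa using hb j
  · intro hy
    exact ⟨fun i => if i = j then y else 0, fun i => by
      dsimp only
      split_ifs with hij
      · exact hij ▸ hy
      · exact hB0 i, by simp⟩

lemma IsNefDual.le_pairing [DecidableEq ι] (h : IsNefDual p A B) (hB0 : ∀ i, (0 : E) ∈ B i)
    {i j : ι} {x w : E} (hx : x ∈ A i) (hw : w ∈ B j) :
    -(if i = j then (1 : ℝ) else 0) ≤ p x w := by
  rw [← h.setOf_eq hB0 j] at hw
  exact hw i x hx

variable [FiniteDimensional ℝ E]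

/-- Nef duality is symmetric. -/
lemma IsNefDual.symm (h : IsNefDual p A B) (hp : ∀ x y, p x y = p y x)
    (hrep : ∀ f : E →ₗ[ℝ] ℝ, ∃ u, ∀ x, f x = p x u)
    (hA : ∀ i, IsCompact (A i)) (hAc : ∀ i, Convex ℝ (A i)) (hA0 : ∀ i, (0 : E) ∈ A i)
    (hB0 : ∀ i, (0 : E) ∈ B i) : IsNefDual p B A := by
  classical
  intro r hr
  apply Subset.antisymm
  · intro x hx
    by_contra hxK
    have hKcomp : IsCompact (∑ i, r i • A i) :=
      Finset.sum_induction _ IsCompact (fun _ _ => IsCompact.add) isCompact_singleton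
        fun i _ => (hA i).smul (r i)
    have hKconv : Convex ℝ (∑ i, r i • A i) := convex_sum _ fun i _ => (hAc i).smul (r i)
    obtain ⟨f, u, hfx, hfK⟩ := geometric_hahn_banach_point_closed hKconv hKcomp.isClosed hxK
    obtain ⟨v, hv⟩ := hrep f
    have hv' : ∀ x, f x = p x v := hv
    obtain ⟨a, ha, hmin, hle⟩ := exists_pairing_le (p := p) hA hA0 v
    obtain ⟨b, hb, hbv⟩ := (h.mem_iff (r := fun i => -p (a i) v) (y := v)
      fun i => neg_nonneg.2 (hle i)).1 fun i x hx => by simpa using hmin i x hx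
    have hlow := hfK _ (mem_sum_smul.2 ⟨a, ha, rfl⟩)
    rw [hv', map_sum, LinearMap.sum_apply] at hlow
    have hxv : f x = ∑ i, -p (a i) v * p x (b i) := by
      rw [hv']
      conv_lhs => rw [← hbv]
      simp
    have : ∑ i, p (r i • a i) v ≤ ∑ i, -p (a i) v * p x (b i) := by
      refine Finset.sum_le_sum fun i _ => ?_
      have h1 := hx i (b i) (hb i)
      rw [hp] at h1
      simp only [map_smul, LinearMap.smul_apply, smul_eq_mul]
      nlinarith [hle i]
    linarith
  · intro x hx
    obtain ⟨a, ha, rfl⟩ := mem_sum_smul.1 hx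
    intro i w hw
    rw [map_sum]
    calc -r i = ∑ j, r j * -(if j = i then (1 : ℝ) else 0) := by simp
      _ ≤ _ := Finset.sum_le_sum fun j _ => by
        rw [map_smul, smul_eq_mul, hp]
        exact mul_le_mul_of_nonneg_left (h.le_pairing hB0 (ha j) hw) (hr j)

/-- The polar dual of `∑ i, A i` is the convex hull of the members of the dual family. -/
lemma IsNefDual.polar_sum (h : IsNefDual p A B) (hA : ∀ i, IsCompact (A i))
    (hA0 : ∀ i, (0 : E) ∈ A i) (hB0 : ∀ i, (0 : E) ∈ B i) [Nonempty ι] :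
    {y | ∀ x ∈ ∑ i, A i, -1 ≤ p x y} = convexHull ℝ (⋃ i, B i) := by
  classical
  apply Subset.antisymm
  · intro y hy
    obtain ⟨a, ha, hmin, hle⟩ := exists_pairing_le (p := p) hA hA0 y
    obtain ⟨b, hb, hby⟩ := (h.mem_iff (r := fun i => -p (a i) y) (y := y)
      fun i => neg_nonneg.2 (hle i)).1 fun i x hx => by simpa using hmin i x hx
    have hsum := hy _ ((Set.mem_fintype_sum _ _).2 ⟨a, ha, rfl⟩)
    rw [map_sum, LinearMap.sum_apply] at hsum
    have hmem : ∀ i, b i ∈ convexHull ℝ (⋃ i, B i) := fun i =>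
      subset_convexHull ℝ _ (mem_iUnion.2 ⟨i, hb i⟩)
    have := sum_smul_mem_smul_of_sum_le (convex_convexHull ℝ (⋃ i, B i))
      (subset_convexHull ℝ _ (mem_iUnion.2 ⟨Classical.arbitrary ι, hB0 _⟩)) Finset.univ
      (a := fun i => -p (a i) y) (z := b) (r := 1) (fun i _ => neg_nonneg.2 (hle i))
      (fun i _ _ => hmem i) (by rw [Finset.sum_neg_distrib]; linarith)
    rwa [hby, one_smul] at this
  · refine convexHull_min (iUnion_subset fun j w hw x hx => ?_) ?_
    · obtain ⟨a, ha, rfl⟩ := (Set.mem_fintype_sum _ _).1 hx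
      rw [map_sum, LinearMap.sum_apply]
      calc (-1 : ℝ) = ∑ i, -(if i = j then (1 : ℝ) else 0) := by simp
        _ ≤ _ := Finset.sum_le_sum fun i _ => h.le_pairing hB0 (ha i) hw
    · have : {y | ∀ x ∈ ∑ i, A i, -1 ≤ p x y} = ⋂ x ∈ ∑ i, A i, {y | -1 ≤ p x y} := by
        ext; simp
      rw [this]
      exact convex_iInter₂ fun x _ => convex_halfSpace_ge (p x).isLinear _

end NefDuality

section Pairing

/-- The standard pairing on `ℝ^n` as a bilinear form. -/
def pairingForm (n : ℕ) : LinearMap.BilinForm ℝ (Fin n → ℝ) :=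
  LinearMap.mk₂ ℝ pairing
    (fun x x' y => by simp [pairing, add_mul, Finset.sum_add_distrib])
    (fun c x y => by simp [pairing, Finset.mul_sum, mul_assoc])
    (fun x y y' => by simp [pairing, mul_add, Finset.sum_add_distrib])
    (fun c x y => by simp [pairing, Finset.mul_sum, mul_left_comm])

lemma pairingForm_apply {n : ℕ} (x y : Fin n → ℝ) : pairingForm n x y = pairing x y := rfl

lemma pairing_comm {n : ℕ} (x y : Fin n → ℝ) : pairing x y = pairing y x := by
  simp [pairing, mul_comm]

lemma exists_eq_pairing {n : ℕ} (f : (Fin n → ℝ) →ₗ[ℝ] ℝ) : ∃ u, ∀ x, f x = pairing x u :=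
  ⟨fun i => f fun j => if i = j then 1 else 0, fun x => f.pi_apply_eq_sum_univ x⟩

/-- The pairing on `ℝ^d ⊕ ℝ^k` as a bilinear form. -/
def pairingVForm (d k : ℕ) : LinearMap.BilinForm ℝ (Vdk d k) :=
  (pairingForm d).compl₁₂ (LinearMap.fst ℝ _ _) (LinearMap.fst ℝ _ _) +
    (pairingForm k).compl₁₂ (LinearMap.snd ℝ _ _) (LinearMap.snd ℝ _ _)

lemma pairingVForm_apply {d k : ℕ} (x y : Vdk d k) : pairingVForm d k x y = pairingV x y := rfl

lemma pairingV_comm {d k : ℕ} (x y : Vdk d k) : pairingV x y = pairingV y x := by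
  simp only [pairingV, pairing_comm]

lemma exists_eq_pairingV {d k : ℕ} (f : Vdk d k →ₗ[ℝ] ℝ) : ∃ u, ∀ x, f x = pairingV x u := by
  obtain ⟨u, hu⟩ := exists_eq_pairing (f ∘ₗ LinearMap.inl ℝ _ _)
  obtain ⟨v, hv⟩ := exists_eq_pairing (f ∘ₗ LinearMap.inr ℝ _ _)
  refine ⟨(u, v), fun x => ?_⟩
  rw [pairingV, ← hu, ← hv]
  simp [← map_add]

lemma IsLatticePt.exists_pairing_eq {n : ℕ} {x y : Fin n → ℝ} (hx : IsLatticePt x)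
    (hy : IsLatticePt y) : ∃ z : ℤ, pairing x y = z := by
  choose a ha using hx
  choose b hb using hy
  exact ⟨∑ i, a i * b i, by simp [pairing, ha, hb]⟩

lemma IsLatticePolytope.isCompact {n : ℕ} {P : Set (Fin n → ℝ)} (h : IsLatticePolytope P) :
    IsCompact P := by
  obtain ⟨S, hS, -, rfl⟩ := h
  exact hS.isCompact_convexHull ℝ

lemma IsLatticePolytope.convex {n : ℕ} {P : Set (Fin n → ℝ)} (h : IsLatticePolytope P) :
    Convex ℝ P := by
  obtain ⟨S, -, -, rfl⟩ := h
  exact convex_convexHull ℝ S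

/-- The minimum of a lattice functional over a lattice polytope is an integer. -/
lemma IsLatticePolytope.exists_int_eq_of_forall_le {n : ℕ} {P : Set (Fin n → ℝ)}
    (h : IsLatticePolytope P) {x w : Fin n → ℝ} (hw : IsLatticePt w) (hx : x ∈ P)
    (hmin : ∀ z ∈ P, pairing x w ≤ pairing z w) : ∃ z : ℤ, pairing x w = z := by
  obtain ⟨S, -, hSl, rfl⟩ := h
  by_contra hne
  have hlt : ∀ y ∈ S, pairing x w < pairing y w := fun y hy =>
    (hmin y (subset_convexHull ℝ S hy)).lt_of_ne fun heq =>
      hne (heq ▸ (hSl y hy).exists_pairing_eq hw)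
  have := convexHull_min (t := {y | pairing x w < pairing y w}) hlt
    (convex_halfSpace_gt ((pairingForm n).flip w).isLinear _) hx
  exact lt_irrefl (pairing x w) this

end Pairing

lemma exists_eq_ite_of_sum_eq_one {ι : Type*} [Fintype ι] [DecidableEq ι] {n : ι → ℤ}
    (hn : ∀ i, 0 ≤ n i) (hs : ∑ i, n i = 1) : ∃ j, ∀ i, n i = if i = j then 1 else 0 := by
  obtain ⟨j, -, hj⟩ := Finset.exists_ne_zero_of_sum_ne_zero (hs ▸ one_ne_zero)
  have hsum := Finset.add_sum_erase Finset.univ n (Finset.mem_univ j)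
  have hnonneg := Finset.sum_nonneg fun i (_ : i ∈ Finset.univ.erase j) => hn i
  have hj0 := hn j
  have hj1 : n j = 1 := by omega
  have hzero := (Finset.sum_eq_zero_iff_of_nonneg
    fun i (_ : i ∈ Finset.univ.erase j) => hn i).1 (by omega)
  refine ⟨j, fun i => ?_⟩
  split_ifs with h
  · rw [h, hj1]
  · exact hzero i (by simp [h])

section NefPartition

variable {d : ℕ} {ι : Type*} [DecidableEq ι]

/-- The members `∇ j` of the dual of a nef-partition. -/
def nefDual (Δ : ι → Set (Fin d → ℝ)) (j : ι) : Set (Fin d → ℝ) :=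
  {y | ∀ i, ∀ x ∈ Δ i, -(if i = j then (1 : ℝ) else 0) ≤ pairing x y}

variable {Δ : ι → Set (Fin d → ℝ)}

lemma zero_mem_nefDual (j : ι) : (0 : Fin d → ℝ) ∈ nefDual Δ j := by
  intro i x _
  split_ifs <;> simp [pairing]

variable [Fintype ι]

/-- A lattice point of the polar dual of `∑ i, Δ i` that attains the value `-1` lies in some
`∇ j`. -/
lemma exists_mem_nefDual (hlat : ∀ i, IsLatticePolytope (Δ i)) (h0 : ∀ i, (0 : Fin d → ℝ) ∈ Δ i)
    {w : Fin d → ℝ} (hwl : IsLatticePt w) (hw : w ∈ polarDual (∑ i, Δ i))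
    {x : ι → Fin d → ℝ} (hx : ∀ i, x i ∈ Δ i) (hsum : ∑ i, pairing (x i) w = -1) :
    ∃ j, w ∈ nefDual Δ j ∧ ∀ i, pairing (x i) w = -(if i = j then (1 : ℝ) else 0) := by
  have hmin : ∀ i, ∀ z ∈ Δ i, pairing (x i) w ≤ pairing z w := by
    intro i z hz
    have h1 : -1 ≤ pairing (∑ j, Function.update x i z j) w := by
      refine hw _ ((Set.mem_fintype_sum _ _).2 ⟨_, fun j => ?_, rfl⟩)
      rcases eq_or_ne j i with rfl | hj
      · simpa using hz
      · simpa [hj] using hx j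
    rw [← pairingForm_apply, map_sum, LinearMap.sum_apply,
      ← Finset.add_sum_erase _ _ (Finset.mem_univ i)] at h1
    rw [← Finset.add_sum_erase _ _ (Finset.mem_univ i)] at hsum
    rw [Finset.sum_congr rfl fun j hj => by
      rw [Function.update_of_ne (Finset.ne_of_mem_erase hj), pairingForm_apply],
      Function.update_self, pairingForm_apply] at h1
    linarith
  choose m hm using fun i => (hlat i).exists_int_eq_of_forall_le hwl (hx i) (hmin i)
  have hm0 : ∀ i, 0 ≤ -m i := fun i => by
    have := hmin i 0 (h0 i)
    rw [hm, ← pairingForm_apply, map_zero, LinearMap.zero_apply] at this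
    have : m i ≤ 0 := by exact_mod_cast this
    omega
  obtain ⟨j, hj⟩ := exists_eq_ite_of_sum_eq_one hm0 (by
    have : ∑ i, (m i : ℝ) = -1 := by simpa [hm] using hsum
    have : ∑ i, m i = -1 := by exact_mod_cast this
    rw [Finset.sum_neg_distrib, this, neg_neg])
  have hval : ∀ i, pairing (x i) w = -(if i = j then (1 : ℝ) else 0) := fun i => by
    rw [hm, ← neg_eq_iff_eq_neg]
    exact_mod_cast hj i
  exact ⟨j, fun i z hz => hval i ▸ hmin i z hz, hval⟩

/-- Points satisfying the inequalities `⟨x, v⟩ ≥ -r i` on `Δ i` decompose along lattice points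
of the `∇ i`. -/
lemma mem_sum_smul_of_le_pairing [Nonempty ι] (hlat : ∀ i, IsLatticePolytope (Δ i))
    (h0 : ∀ i, (0 : Fin d → ℝ) ∈ Δ i) (hint : (0 : Fin d → ℝ) ∈ interior (∑ i, Δ i))
    {S : Set (Fin d → ℝ)} (hS : S.Finite) (hSl : ∀ x ∈ S, IsLatticePt x)
    (hpolar : polarDual (∑ i, Δ i) = convexHull ℝ S) {r : ι → ℝ} {v : Fin d → ℝ}
    (hv : ∀ i, ∀ x ∈ Δ i, -r i ≤ pairing x v) :
    v ∈ ∑ i, r i • convexHull ℝ (insert 0 (S ∩ nefDual Δ i)) := by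
  have hB0 : ∀ i, (0 : Fin d → ℝ) ∈ convexHull ℝ (insert 0 (S ∩ nefDual Δ i)) := fun i =>
    subset_convexHull ℝ _ (mem_insert 0 _)
  rcases eq_or_ne v 0 with rfl | hv0
  · exact mem_sum_smul.2 ⟨0, hB0, by simp⟩
  obtain ⟨x, hx, hmin, -⟩ := exists_pairing_le (p := pairingForm d)
    (fun i => (hlat i).isCompact) h0 v
  simp only [pairingForm_apply] at hmin
  have hminsum : ∀ z ∈ ∑ i, Δ i, ∑ i, pairing (x i) v ≤ pairing z v := by
    intro z hz
    obtain ⟨g, hg, rfl⟩ := (Set.mem_fintype_sum _ _).1 hz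
    rw [← pairingForm_apply, map_sum, LinearMap.sum_apply]
    exact Finset.sum_le_sum fun i _ => hmin i _ (hg i)
  obtain ⟨m, hm⟩ : ∃ m, m = -∑ i, pairing (x i) v := ⟨_, rfl⟩
  have hvv : 0 < pairing v v := by
    obtain ⟨i, hi⟩ := Function.ne_iff.1 hv0
    exact Finset.sum_pos' (fun j _ => mul_self_nonneg (v j))
      ⟨i, Finset.mem_univ i, mul_self_pos.2 hi⟩
  have hm0 : 0 < m := by
    have htend : Filter.Tendsto (fun t : ℝ => t • v) (nhdsWithin 0 (Iio 0)) (nhds 0) := by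
      have : Continuous fun t : ℝ => t • v := by fun_prop
      simpa using (this.tendsto 0).mono_left nhdsWithin_le_nhds
    obtain ⟨t, ht, htneg⟩ := ((htend.eventually (mem_interior_iff_mem_nhds.1 hint)).and
      self_mem_nhdsWithin).exists
    have := hminsum _ ht
    rw [← pairingForm_apply, map_smul, LinearMap.smul_apply, smul_eq_mul,
      pairingForm_apply] at this
    nlinarith [mul_pos (neg_pos.2 htneg) hvv]
  have hvm : m⁻¹ • v ∈ polarDual (∑ i, Δ i) := by
    intro z hz
    have := hminsum z hz
    rw [← pairingForm_apply, map_smul, smul_eq_mul, pairingForm_apply, inv_mul_eq_div,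
      le_div_iff₀ hm0]
    linarith
  lift S to Finset (Fin d → ℝ) using hS
  rw [hpolar] at hvm
  obtain ⟨c, hc0, hc1, hcv⟩ := Finset.mem_convexHull'.1 hvm
  have hcsum : ∀ y, pairing y v = m * ∑ w ∈ S, c w * pairing y w := by
    intro y
    have : v = m • ∑ w ∈ S, c w • w := by rw [hcv, smul_inv_smul₀ hm0.ne']
    conv_lhs => rw [this]
    rw [← pairingForm_apply]
    simp [pairingForm_apply]
  have hSp : ∀ w ∈ S, w ∈ polarDual (∑ i, Δ i) := fun w hw =>
    hpolar ▸ subset_convexHull ℝ _ hw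
  have hge : ∀ w ∈ S, -1 ≤ ∑ i, pairing (x i) w := by
    intro w hw
    have := hSp w hw _ ((Set.mem_fintype_sum _ _).2 ⟨x, hx, rfl⟩)
    rwa [← pairingForm_apply, map_sum, LinearMap.sum_apply] at this
  have htight : ∀ w ∈ S, c w ≠ 0 → ∑ i, pairing (x i) w = -1 := by
    have hzero : ∑ w ∈ S, c w * (∑ i, pairing (x i) w + 1) = 0 := by
      have h1 : m * ∑ w ∈ S, c w * ∑ i, pairing (x i) w = -m := by
        rw [hm, neg_neg, ← hm]
        simp_rw [hcsum, ← Finset.mul_sum]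
        rw [Finset.sum_comm]
        simp_rw [Finset.mul_sum]
      have h2 : ∑ w ∈ S, c w * ∑ i, pairing (x i) w = -1 :=
        mul_left_cancel₀ hm0.ne' (by linarith)
      simp_rw [mul_add, Finset.sum_add_distrib, mul_one, h2, hc1]
      norm_num
    intro w hw hcw
    have := (Finset.sum_eq_zero_iff_of_nonneg fun w hw =>
      mul_nonneg (hc0 w hw) (by linarith [hge w hw])).1 hzero w hw
    have := (mul_eq_zero.1 this).resolve_left hcw
    linarith
  have hcls : ∀ w, ∃ j, w ∈ S → c w ≠ 0 →
      w ∈ nefDual Δ j ∧ ∀ i, pairing (x i) w = -(if i = j then (1 : ℝ) else 0) := by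
    intro w
    by_cases hw : w ∈ S ∧ c w ≠ 0
    · obtain ⟨j, hj⟩ := exists_mem_nefDual hlat h0 (hSl w hw.1) (hSp w hw.1) hx
        (htight w hw.1 hw.2)
      exact ⟨j, fun _ _ => hj⟩
    · exact ⟨Classical.arbitrary ι, fun h1 h2 => (hw ⟨h1, h2⟩).elim⟩
  choose cls hcls using hcls
  have hdecomp : v = ∑ i, ∑ w ∈ S with cls w = i, (m * c w) • w := by
    rw [Finset.sum_fiberwise]
    simp_rw [mul_smul, ← Finset.smul_sum]
    rw [hcv, smul_inv_smul₀ hm0.ne']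
  rw [hdecomp]
  refine (Set.mem_fintype_sum _ _).2 ⟨_, fun i => ?_, rfl⟩
  refine sum_smul_mem_smul_of_sum_le (convex_convexHull ℝ _) (hB0 i) _ (z := fun w => w)
    (fun w hw => mul_nonneg hm0.le (hc0 w (Finset.mem_filter.1 hw).1)) ?_ ?_
  · intro w hw hcw
    obtain ⟨hwS, rfl⟩ := Finset.mem_filter.1 hw
    exact subset_convexHull ℝ _ (mem_insert_of_mem _
      ⟨hwS, (hcls w hwS (right_ne_zero_of_mul hcw)).1⟩)
  · have h1 : pairing (x i) v = -∑ w ∈ S with cls w = i, m * c w := by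
      rw [hcsum, Finset.mul_sum, Finset.sum_filter, ← Finset.sum_neg_distrib]
      refine Finset.sum_congr rfl fun w hw => ?_
      rcases eq_or_ne (c w) 0 with h | h
      · simp [h]
      · rw [(hcls w hw h).2 i]
        rcases eq_or_ne (cls w) i with h' | h'
        · simp [h']
        · simp [h', h'.symm]
    linarith [hv i _ (hx i)]


variable [Nonempty ι]

lemma isLatticePolytope_nefDual (hlat : ∀ i, IsLatticePolytope (Δ i))
    (h0 : ∀ i, (0 : Fin d → ℝ) ∈ Δ i) (hrefl : IsReflexive (∑ i, Δ i)) (j : ι) :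
    IsLatticePolytope (nefDual Δ j) := by
  obtain ⟨-, hint, S, hS, hSl, hpolar⟩ := hrefl
  have hsub : convexHull ℝ (insert 0 (S ∩ nefDual Δ j)) ⊆ nefDual Δ j := by
    refine convexHull_min (insert_subset (zero_mem_nefDual j) inter_subset_right) ?_
    have : nefDual Δ j =
        ⋂ i, ⋂ x ∈ Δ i, {y | -(if i = j then (1 : ℝ) else 0) ≤ pairing x y} := by
      ext; simp [nefDual]
    rw [this]
    exact convex_iInter fun i => convex_iInter₂ fun x _ =>
      convex_halfSpace_ge (pairingForm d x).isLinear _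
  refine ⟨insert 0 (S ∩ nefDual Δ j), (hS.inter_of_left _).insert 0, ?_, hsub.antisymm' ?_⟩
  · rintro x (rfl | hx)
    · exact fun i => ⟨0, by simp⟩
    · exact hSl x hx.1
  · intro v hv
    obtain ⟨b, hb, rfl⟩ := mem_sum_smul.1 (mem_sum_smul_of_le_pairing hlat h0 hint hS hSl hpolar
      (r := fun i => if i = j then 1 else 0) hv)
    simpa using hb j

lemma isNefDual_nefDual (hlat : ∀ i, IsLatticePolytope (Δ i))
    (h0 : ∀ i, (0 : Fin d → ℝ) ∈ Δ i) (hrefl : IsReflexive (∑ i, Δ i)) :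
    IsNefDual (pairingForm d) Δ (nefDual Δ) := by
  have hlat' := isLatticePolytope_nefDual hlat h0 hrefl
  obtain ⟨-, hint, S, hS, hSl, hpolar⟩ := hrefl
  intro r hr
  apply Subset.antisymm
  · intro v hv
    obtain ⟨b, hb, rfl⟩ := mem_sum_smul.1
      (mem_sum_smul_of_le_pairing hlat h0 hint hS hSl hpolar hv)
    exact mem_sum_smul.2 ⟨b, fun i => convexHull_min
      (insert_subset (zero_mem_nefDual i) inter_subset_right) (hlat' i).convex (hb i), rfl⟩
  · intro v hv i x hx
    obtain ⟨b, hb, rfl⟩ := mem_sum_smul.1 hv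
    rw [map_sum]
    calc -r i = ∑ j, r j * -(if i = j then (1 : ℝ) else 0) := by simp
      _ ≤ _ := Finset.sum_le_sum fun j _ => by
        rw [map_smul, smul_eq_mul]
        exact mul_le_mul_of_nonneg_left (hb j i x hx) (hr j)

end NefPartition

section LatticePolytopeV

variable {d k : ℕ}

lemma IsLatticePolytopeV.isCompact {P : Set (Vdk d k)} (h : IsLatticePolytopeV P) :
    IsCompact P := by
  obtain ⟨S, hS, -, rfl⟩ := h
  exact hS.isCompact_convexHull ℝ

lemma IsLatticePolytopeV.convex {P : Set (Vdk d k)} (h : IsLatticePolytopeV P) :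
    Convex ℝ P := by
  obtain ⟨S, -, -, rfl⟩ := h
  exact convex_convexHull ℝ S

lemma IsLatticePt.add {n : ℕ} {x y : Fin n → ℝ} (hx : IsLatticePt x) (hy : IsLatticePt y) :
    IsLatticePt (x + y) := fun i => by
  obtain ⟨a, ha⟩ := hx i
  obtain ⟨b, hb⟩ := hy i
  exact ⟨a + b, by simp [ha, hb]⟩

lemma IsLatticePt.neg {n : ℕ} {x : Fin n → ℝ} (hx : IsLatticePt x) : IsLatticePt (-x) :=
  fun i => by
    obtain ⟨a, ha⟩ := hx i
    exact ⟨-a, by simp [ha]⟩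

lemma isLatticePt_zero {n : ℕ} : IsLatticePt (0 : Fin n → ℝ) := fun _ => ⟨0, by simp⟩

lemma isLatticePt_single {n : ℕ} (i : Fin n) : IsLatticePt (Pi.single i (1 : ℝ)) := fun j => by
  rcases eq_or_ne j i with rfl | h
  · exact ⟨1, by simp⟩
  · exact ⟨0, by simp [h]⟩

lemma isLatticePt_nshift (i : Fin (k + 1)) : IsLatticePt (nshift i : Fin k → ℝ) := by
  cases i using Fin.cases with
  | zero => exact isLatticePt_zero
  | succ i => exact isLatticePt_single i

lemma isLatticePt_evec (i : Fin (k + 1)) : IsLatticePt (evec i : Fin k → ℝ) := by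
  cases i using Fin.cases with
  | zero => exact fun _ => ⟨-1, by simp [evec]⟩
  | succ i => exact isLatticePt_single i

lemma isLatticePolytopeV_singleton {v : Vdk d k} (hv : IsLatticePtV v) :
    IsLatticePolytopeV {v} :=
  ⟨{v}, finite_singleton v, by simpa using hv, (convexHull_singleton v).symm⟩

lemma IsLatticePolytopeV.add {P Q : Set (Vdk d k)} (hP : IsLatticePolytopeV P)
    (hQ : IsLatticePolytopeV Q) : IsLatticePolytopeV (P + Q) := by
  obtain ⟨S, hS, hSl, rfl⟩ := hP
  obtain ⟨T, hT, hTl, rfl⟩ := hQ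
  refine ⟨S + T, hS.add hT, ?_, (convexHull_add S T).symm⟩
  rintro _ ⟨x, hx, y, hy, rfl⟩
  exact ⟨(hSl x hx).1.add (hTl y hy).1, (hSl x hx).2.add (hTl y hy).2⟩

lemma isLatticePolytopeV_sum {ι : Type*} [Fintype ι] {P : ι → Set (Vdk d k)}
    (hP : ∀ i, IsLatticePolytopeV (P i)) : IsLatticePolytopeV (∑ i, P i) :=
  Finset.sum_induction _ IsLatticePolytopeV (fun _ _ => IsLatticePolytopeV.add)
    (isLatticePolytopeV_singleton ⟨isLatticePt_zero, isLatticePt_zero⟩) fun i _ => hP i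

lemma isLatticePolytopeV_convexHull_iUnion {ι : Type*} [Finite ι] {P : ι → Set (Vdk d k)}
    (hP : ∀ i, IsLatticePolytopeV (P i)) : IsLatticePolytopeV (convexHull ℝ (⋃ i, P i)) := by
  choose S hS hSl hPS using hP
  refine ⟨⋃ i, S i, finite_iUnion hS, fun x hx => ?_, Subset.antisymm ?_ ?_⟩
  · obtain ⟨i, hi⟩ := mem_iUnion.1 hx
    exact hSl i x hi
  · refine convexHull_min (iUnion_subset fun i => ?_) (convex_convexHull ℝ _)
    rw [hPS]
    exact convexHull_mono (subset_iUnion S i)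
  · refine convexHull_mono (iUnion_mono fun i => ?_)
    rw [hPS]
    exact subset_convexHull ℝ _

lemma IsLatticePolytope.image_prodMk {P : Set (Fin d → ℝ)} (hP : IsLatticePolytope P)
    {e : Fin k → ℝ} (he : IsLatticePt e) :
    IsLatticePolytopeV ((fun x => ((x, e) : Vdk d k)) '' P) := by
  obtain ⟨S, hS, hSl, rfl⟩ := hP
  refine ⟨(fun x => (x, e)) '' S, hS.image _, ?_, ?_⟩
  · rintro _ ⟨x, hx, rfl⟩
    exact ⟨hSl x hx, he⟩
  · rw [← prod_singleton, ← prod_singleton, convexHull_prod, convexHull_singleton]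

end LatticePolytopeV

section Cayley

variable {d k : ℕ}

/-- `Conv(P₀, P₁ + e₁, …, P_k + e_k)` translated by `-eᵢ` for `i ≥ 1` and by `0` for `i = 0`. -/
def cayleyHat (P : Fin (k + 1) → Set (Fin d → ℝ)) (i : Fin (k + 1)) : Set (Vdk d k) :=
  convexHull ℝ (⋃ a : Fin (k + 1), (fun x => ((x, nshift a) : Vdk d k)) '' P a) +
    {(0, -nshift i)}

/-- `Conv((Pᵢ + eᵢ) ∪ {0})`. -/
def cayleyTilde (P : Fin (k + 1) → Set (Fin d → ℝ)) (i : Fin (k + 1)) : Set (Vdk d k) :=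
  convexHull ℝ ((fun x => ((x, evec i) : Vdk d k)) '' P i ∪ {0})

lemma cayleyHat_eq_cases (P : Fin (k + 1) → Set (Fin d → ℝ)) :
    cayleyHat P = Fin.cases
      (convexHull ℝ (⋃ i : Fin (k + 1), (fun x => ((x, nshift i) : Vdk d k)) '' P i))
      (fun i => (fun y => y - (((0 : Fin d → ℝ), Pi.single i 1) : Vdk d k)) ''
        convexHull ℝ (⋃ i : Fin (k + 1), (fun x => ((x, nshift i) : Vdk d k)) '' P i)) := by
  funext i
  cases i using Fin.cases with
  | zero =>
    change _ + {((0 : Fin d → ℝ), -(0 : Fin k → ℝ))} = _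
    rw [neg_zero, Prod.mk_zero_zero, singleton_zero, add_zero]
    rfl
  | succ i => simp [cayleyHat, nshift, sub_eq_add_neg]

variable {A B : Fin (k + 1) → Set (Fin d → ℝ)}

lemma isLatticePolytopeV_cayleyHat (hB : ∀ i, IsLatticePolytope (B i)) (i : Fin (k + 1)) :
    IsLatticePolytopeV (cayleyHat B i) :=
  (isLatticePolytopeV_convexHull_iUnion fun a =>
    (hB a).image_prodMk (isLatticePt_nshift a)).add
    (isLatticePolytopeV_singleton ⟨isLatticePt_zero, (isLatticePt_nshift i).neg⟩)

lemma zero_mem_cayleyHat (hB0 : ∀ i, (0 : Fin d → ℝ) ∈ B i) (i : Fin (k + 1)) :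
    (0 : Vdk d k) ∈ cayleyHat B i :=
  ⟨(0, nshift i), subset_convexHull ℝ _ (mem_iUnion.2 ⟨i, 0, hB0 i, rfl⟩), _, rfl, by simp⟩

lemma isLatticePolytopeV_cayleyTilde (hA : ∀ i, IsLatticePolytope (A i)) (i : Fin (k + 1)) :
    IsLatticePolytopeV (cayleyTilde A i) := by
  rw [cayleyTilde, union_eq_iUnion]
  refine isLatticePolytopeV_convexHull_iUnion fun b => ?_
  cases b
  · exact isLatticePolytopeV_singleton ⟨isLatticePt_zero, isLatticePt_zero⟩
  · exact (hA i).image_prodMk (isLatticePt_evec i)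

lemma zero_mem_cayleyTilde (i : Fin (k + 1)) : (0 : Vdk d k) ∈ cayleyTilde A i :=
  subset_convexHull ℝ _ (Or.inr rfl)

lemma mem_cayleyTilde_iff {i : Fin (k + 1)} (hA : Convex ℝ (A i)) (hA0 : (0 : Fin d → ℝ) ∈ A i)
    {y : Vdk d k} :
    y ∈ cayleyTilde A i ↔ ∃ r : ℝ, 0 ≤ r ∧ r ≤ 1 ∧ ∃ x ∈ A i, r • ((x, evec i) : Vdk d k) = y := by
  have himg : Convex ℝ ((fun x => ((x, evec i) : Vdk d k)) '' A i) := by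
    rw [← prod_singleton]
    exact hA.prod (convex_singleton _)
  rw [cayleyTilde, union_singleton, convexHull_insert (Nonempty.image _ ⟨0, hA0⟩), himg.convexHull_eq,
    convexJoin_singleton_left]
  simp only [mem_iUnion, segment_eq_image]
  constructor
  · rintro ⟨_, ⟨x, hx, rfl⟩, r, ⟨hr0, hr1⟩, rfl⟩
    exact ⟨r, hr0, hr1, x, hx, by simp⟩
  · rintro ⟨r, hr0, hr1, x, hx, rfl⟩
    exact ⟨_, ⟨x, hx, rfl⟩, r, ⟨hr0, hr1⟩, by simp⟩

lemma pairing_nshift_evec (a b : Fin (k + 1)) :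
    pairing (nshift b : Fin k → ℝ) (evec a) =
      (if b = a then 1 else 0) - (if a = 0 then 1 else 0) := by
  cases a using Fin.cases with
  | zero =>
    cases b using Fin.cases with
    | zero => simp [pairing, nshift]
    | succ b => simp [pairing, nshift, evec, Fin.succ_ne_zero, Pi.single_apply]
  | succ a =>
    cases b using Fin.cases with
    | zero => simp [pairing, nshift, Fin.succ_ne_zero, (Fin.succ_ne_zero a).symm]
    | succ b => simp [pairing, nshift, evec, Fin.succ_ne_zero, Pi.single_apply, eq_comm]

lemma pairing_nshift_zero (t : Fin k → ℝ) : pairing (nshift 0) t = 0 := by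
  simp [pairing, nshift]

lemma pairing_nshift_succ (i : Fin k) (t : Fin k → ℝ) : pairing (nshift i.succ) t = t i := by
  simp [pairing, nshift, Pi.single_apply]

lemma sum_smul_evec (r : Fin (k + 1) → ℝ) (i : Fin k) :
    (∑ a, r a • (evec a : Fin k → ℝ)) i = r i.succ - r 0 := by
  simp [Fin.sum_univ_succ, evec, Pi.single_apply]
  ring

lemma forall_mem_cayleyHat_iff {i : Fin (k + 1)} {c : ℝ} {y : Vdk d k} :
    (∀ x ∈ cayleyHat B i, c ≤ pairingVForm d k x y) ↔
      ∀ a, ∀ w ∈ B a,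
        c ≤ pairing w y.1 + pairing (nshift a) y.2 - pairing (nshift i) y.2 := by
  have hneg : pairingVForm d k (0, -nshift i) y = -pairing (nshift i) y.2 := by
    have : ((0, -nshift i) : Vdk d k) = -(0, nshift i) := by simp
    rw [this, map_neg, LinearMap.neg_apply, pairingVForm_apply]
    simp [pairingV, pairing]
  have : (∀ x ∈ cayleyHat B i, c ≤ pairingVForm d k x y) ↔
      ∀ x ∈ convexHull ℝ (⋃ a : Fin (k + 1), (fun x => ((x, nshift a) : Vdk d k)) '' B a),
        c + pairing (nshift i) y.2 ≤ pairingVForm d k x y := by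
    rw [cayleyHat, add_singleton, forall_mem_image]
    refine forall₂_congr fun x _ => ?_
    rw [map_add, LinearMap.add_apply, hneg, ← sub_eq_add_neg, le_sub_iff_add_le]
  rw [this, forall_mem_convexHull_iff]
  simp only [mem_iUnion, forall_exists_index]
  rw [forall_comm]
  refine forall_congr' fun a => ?_
  rw [forall_mem_image]
  refine forall₂_congr fun w _ => ?_
  rw [pairingVForm_apply, pairingV, le_sub_iff_add_le]

/-- The families `cayleyHat B` and `cayleyTilde A` are nef dual if `B` and `A` are. -/
lemma IsNefDual.cayley (h : IsNefDual (pairingForm d) B A) (hAc : ∀ i, Convex ℝ (A i))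
    (hA0 : ∀ i, (0 : Fin d → ℝ) ∈ A i) (hB0 : ∀ i, (0 : Fin d → ℝ) ∈ B i) :
    IsNefDual (pairingVForm d k) (cayleyHat B) (cayleyTilde A) := by
  intro c hc
  ext y
  rw [mem_sum_smul, mem_ofPred_eq]
  simp_rw [forall_mem_cayleyHat_iff]
  constructor
  · intro hy
    obtain ⟨i₀, hi₀⟩ := Finite.exists_min fun i => c i - pairing (nshift i) y.2
    obtain ⟨r, hr⟩ : ∃ r : Fin (k + 1) → ℝ, ∀ a, r a =
      c i₀ - pairing (nshift i₀) y.2 + pairing (nshift a) y.2 := ⟨_, fun _ => rfl⟩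
    have hr0 : ∀ a, 0 ≤ r a := fun a => by
      have := hy i₀ a 0 (hB0 a)
      rw [← pairingForm_apply, map_zero, LinearMap.zero_apply] at this
      linarith [hr a]
    have hrc : ∀ a, r a ≤ c a := fun a => by linarith [hr a, hi₀ a]
    obtain ⟨x, hx, hxy⟩ := (h.mem_iff hr0 (y := y.1)).1 fun a w hw => by
      rw [pairingForm_apply]
      linarith [hr a, hy i₀ a w hw]
    have hy2 : ∑ a, r a • (evec a : Fin k → ℝ) = y.2 := by
      funext i
      rw [sum_smul_evec, hr, hr, pairing_nshift_succ, pairing_nshift_zero]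
      ring
    refine ⟨fun a => (r a / c a) • (x a, evec a), fun a => ?_, ?_⟩
    · exact (mem_cayleyTilde_iff (hAc a) (hA0 a)).2
        ⟨_, div_nonneg (hr0 a) (hc a), div_le_one_of_le₀ (hrc a) (hc a), x a, hx a, rfl⟩
    · have : ∀ a, c a * (r a / c a) = r a := fun a =>
        mul_div_cancel_of_imp' fun h0 => le_antisymm (h0 ▸ hrc a) (hr0 a)
      simp only [smul_smul, this]
      ext1
      · simpa [Prod.fst_sum] using hxy
      · simpa [Prod.snd_sum] using hy2
  · rintro ⟨z, hz, rfl⟩ i b w hw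
    choose r hr0 hr1 x hx hxz using fun a => (mem_cayleyTilde_iff (hAc a) (hA0 a)).1 (hz a)
    have hlin : ∀ a, pairing w (z a).1 + pairing (nshift b) (z a).2 - pairing (nshift i) (z a).2
        = r a * (pairing w (x a) + (if b = a then 1 else 0) - (if i = a then 1 else 0)) := by
      intro a
      rw [← hxz a, Prod.smul_fst, Prod.smul_snd]
      simp only [← pairingForm_apply, map_smul, smul_eq_mul]
      simp only [pairingForm_apply, pairing_nshift_evec]
      ring
    have hsum : pairing w (∑ a, c a • z a).1 + pairing (nshift b) (∑ a, c a • z a).2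
        - pairing (nshift i) (∑ a, c a • z a).2 = ∑ a, c a * (pairing w (z a).1
          + pairing (nshift b) (z a).2 - pairing (nshift i) (z a).2) := by
      simp only [Prod.fst_sum, Prod.snd_sum, Prod.smul_fst, Prod.smul_snd, ← pairingForm_apply,
        map_sum, map_smul, smul_eq_mul, mul_sub, mul_add, Finset.sum_add_distrib,
        Finset.sum_sub_distrib]
    rw [hsum]
    calc -c i = ∑ a, c a * -(if i = a then (1 : ℝ) else 0) := by simp
      _ ≤ _ := Finset.sum_le_sum fun a _ => by
        refine mul_le_mul_of_nonneg_left ?_ (hc a)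
        rw [hlin]
        have h1 := h.le_pairing hA0 hw (hx a)
        rw [pairingForm_apply] at h1
        have h2 : (0 : ℝ) ≤ if i = a then 1 else 0 := by split_ifs <;> norm_num
        nlinarith [hr0 a, hr1 a, mul_nonneg (hr0 a) (neg_le_iff_add_nonneg.1 h1)]

/-- The properties of the polytopes `cayleyHat B` and `cayleyTilde A` for nef dual `B` and `A`. -/
lemma IsNefDual.cayley_polytopes (h : IsNefDual (pairingForm d) B A)
    (hA : ∀ i, IsLatticePolytope (A i)) (hB : ∀ i, IsLatticePolytope (B i))
    (hA0 : ∀ i, (0 : Fin d → ℝ) ∈ A i) (hB0 : ∀ i, (0 : Fin d → ℝ) ∈ B i) :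
    polarDualV (convexHull ℝ (⋃ i, cayleyTilde A i)) = ∑ i, cayleyHat B i ∧
    (∀ i, IsLatticePolytopeV (cayleyHat B i) ∧ (0 : Vdk d k) ∈ cayleyHat B i) ∧
    IsReflexiveV (∑ i, cayleyHat B i) ∧
    (∀ j, {y : Vdk d k | ∀ i, ∀ x ∈ cayleyHat B i,
        -(if i = j then (1 : ℝ) else 0) ≤ pairingV x y} = cayleyTilde A j) ∧
    polarDualV (convexHull ℝ (⋃ i, cayleyHat B i)) = ∑ i, cayleyTilde A i := by
  have hhat := isLatticePolytopeV_cayleyHat hB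
  have hhat0 := zero_mem_cayleyHat hB0
  have htilde := isLatticePolytopeV_cayleyTilde hA
  have hdual := h.cayley (fun i => (hA i).convex) hA0 hB0
  have hdual' := hdual.symm pairingV_comm exists_eq_pairingV (fun i => (hhat i).isCompact)
    (fun i => (hhat i).convex) hhat0 zero_mem_cayleyTilde
  have hpolar : ∀ {P Q : Fin (k + 1) → Set (Vdk d k)}, IsNefDual (pairingVForm d k) P Q →
      polarDualV (convexHull ℝ (⋃ i, P i)) = ∑ i, Q i := by
    intro P Q hPQ
    have := hPQ 1 fun _ => zero_le_one
    simp only [Pi.one_apply, one_smul] at this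
    rw [← this]
    ext y
    refine (forall_mem_convexHull_iff (p := pairingVForm d k)).trans ?_
    simp only [mem_iUnion, forall_exists_index, mem_ofPred_eq]
    exact forall_comm
  refine ⟨hpolar hdual', fun i => ⟨hhat i, hhat0 i⟩, ⟨isLatticePolytopeV_sum hhat, ?_, ?_⟩,
    hdual.setOf_eq zero_mem_cayleyTilde, hpolar hdual⟩
  · rw [← hpolar hdual']
    obtain ⟨T, hT, -, hTeq⟩ := isLatticePolytopeV_convexHull_iUnion htilde
    rw [hTeq]
    exact zero_mem_interior_polar (p := pairingVForm d k) hT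
  · have : polarDualV (∑ i, cayleyHat B i) = convexHull ℝ (⋃ i, cayleyTilde A i) :=
      hdual.polar_sum (fun i => (hhat i).isCompact) hhat0 zero_mem_cayleyTilde
    exact this ▸ isLatticePolytopeV_convexHull_iUnion htilde

end Cayley

/-- the eight reflexive polytopes associated to a dual pair of nef-partitions:
`(Δ̃₀ ⊎ ⋯ ⊎ Δ̃_k)* = ∇̂₀ + ⋯ + ∇̂_k` and `(∇̃₀ ⊎ ⋯ ⊎ ∇̃_k)* = Δ̂₀ + ⋯ + Δ̂_k` are
nef-partitions with dual nef-partitions `Δ̃₀ + ⋯ + Δ̃_k` and `∇̃₀ + ⋯ + ∇̃_k`, and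
`(∇̂₀ ⊎ ⋯ ⊎ ∇̂_k)* = Δ̃₀ + ⋯ + Δ̃_k`, `(Δ̂₀ ⊎ ⋯ ⊎ Δ̂_k)* = ∇̃₀ + ⋯ + ∇̃_k`. -/
theorem eight_reflexive_polytopes {d k : ℕ}
    (Δ : Fin (k+1) → Set (Fin d → ℝ))
    (hlat : ∀ i, IsLatticePolytope (Δ i))
    (h0 : ∀ i, (0 : Fin d → ℝ) ∈ Δ i)
    (hrefl : IsReflexive (∑ i, Δ i))
    -- the dual nef-partition ∇ = ∇₀ + ⋯ + ∇_k
    (nabla : Fin (k+1) → Set (Fin d → ℝ))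
    (hnabla : nabla = fun j =>
        {y | ∀ i, ∀ x ∈ Δ i, -(if i = j then (1 : ℝ) else 0) ≤ pairing x y})
    -- Δ̂₀ = Conv(Δ₀, Δ₁ + e₁, …, Δ_k + e_k), Δ̂ᵢ = Δ̂₀ − eᵢ
    (Δhat : Fin (k+1) → Set (Vdk d k))
    (hΔhat : Δhat = Fin.cases
        (convexHull ℝ (⋃ i : Fin (k+1), (fun x => ((x, nshift i) : Vdk d k)) '' Δ i))
        (fun i => (fun y => y - (((0 : Fin d → ℝ), Pi.single i 1) : Vdk d k)) ''
          convexHull ℝ (⋃ i : Fin (k+1), (fun x => ((x, nshift i) : Vdk d k)) '' Δ i)))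
    -- ∇̂₀ = Conv(∇₀, ∇₁ + e₁*, …, ∇_k + e_k*), ∇̂ᵢ = ∇̂₀ − eᵢ*
    (Nhat : Fin (k+1) → Set (Vdk d k))
    (hNhat : Nhat = Fin.cases
        (convexHull ℝ (⋃ i : Fin (k+1), (fun x => ((x, nshift i) : Vdk d k)) '' nabla i))
        (fun i => (fun y => y - (((0 : Fin d → ℝ), Pi.single i 1) : Vdk d k)) ''
          convexHull ℝ (⋃ i : Fin (k+1), (fun x => ((x, nshift i) : Vdk d k)) '' nabla i)))
    -- Δ̃ᵢ = Conv((Δᵢ + eᵢ) ∪ {0})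
    (Δtilde : Fin (k+1) → Set (Vdk d k))
    (hΔtilde : Δtilde = fun i =>
        convexHull ℝ ((fun x => ((x, evec i) : Vdk d k)) '' Δ i ∪ {0}))
    -- ∇̃ᵢ = Conv((∇ᵢ + eᵢ*) ∪ {0})
    (Ntilde : Fin (k+1) → Set (Vdk d k))
    (hNtilde : Ntilde = fun i =>
        convexHull ℝ ((fun x => ((x, evec i) : Vdk d k)) '' nabla i ∪ {0})) :
    -- (Δ̃₀ ⊎ ⋯ ⊎ Δ̃_k)* = ∇̂₀ + ⋯ + ∇̂_k
    polarDualV (convexHull ℝ (⋃ i, Δtilde i)) = ∑ i, Nhat i ∧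
    -- (∇̃₀ ⊎ ⋯ ⊎ ∇̃_k)* = Δ̂₀ + ⋯ + Δ̂_k
    polarDualV (convexHull ℝ (⋃ i, Ntilde i)) = ∑ i, Δhat i ∧
    -- these are nef-partitions of reflexive polytopes
    (∀ i, IsLatticePolytopeV (Nhat i) ∧ (0 : Vdk d k) ∈ Nhat i) ∧
    IsReflexiveV (∑ i, Nhat i) ∧
    (∀ i, IsLatticePolytopeV (Δhat i) ∧ (0 : Vdk d k) ∈ Δhat i) ∧
    IsReflexiveV (∑ i, Δhat i) ∧
    -- the dual nef-partition of ∇̂₀ + ⋯ + ∇̂_k is Δ̃₀ + ⋯ + Δ̃_k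
    (∀ j, {y : Vdk d k | ∀ i, ∀ x ∈ Nhat i,
        -(if i = j then (1 : ℝ) else 0) ≤ pairingV x y} = Δtilde j) ∧
    -- the dual nef-partition of Δ̂₀ + ⋯ + Δ̂_k is ∇̃₀ + ⋯ + ∇̃_k
    (∀ j, {y : Vdk d k | ∀ i, ∀ x ∈ Δhat i,
        -(if i = j then (1 : ℝ) else 0) ≤ pairingV x y} = Ntilde j) ∧
    -- (∇̂₀ ⊎ ⋯ ⊎ ∇̂_k)* = Δ̃₀ + ⋯ + Δ̃_k
    polarDualV (convexHull ℝ (⋃ i, Nhat i)) = ∑ i, Δtilde i ∧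
    -- (Δ̂₀ ⊎ ⋯ ⊎ Δ̂_k)* = ∇̃₀ + ⋯ + ∇̃_k
    polarDualV (convexHull ℝ (⋃ i, Δhat i)) = ∑ i, Ntilde i := by
  subst hnabla hΔhat hNhat hΔtilde hNtilde
  have hN := isLatticePolytope_nefDual hlat h0 hrefl
  have hN0 := zero_mem_nefDual (Δ := Δ)
  have hdual := isNefDual_nefDual hlat h0 hrefl
  have hdual' := hdual.symm pairing_comm exists_eq_pairing (fun i => (hlat i).isCompact)
    (fun i => (hlat i).convex) h0 hN0
  obtain ⟨a1, a2, a3, a4, a5⟩ := hdual'.cayley_polytopes hlat hN h0 hN0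
  obtain ⟨b1, b2, b3, b4, b5⟩ := hdual.cayley_polytopes hN hlat hN0 h0
  rw [cayleyHat_eq_cases] at a1 a2 a3 a4 a5 b1 b2 b3 b4 b5
  exact ⟨a1, b1, a2, a3, b2, b3, a4, b4, a5, b5⟩
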